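/- arXiv:1606.06858 — 2 statements merged into one kernel-verified Lean document; each statement's English description precedes it below -/
import Mathlib

section
/- For every even natural number n ≥ 4, every even k with 2 ≤ k ≤ n−2, and every odd natural number p ≥ 1, the power μ_{n,k}^p lies in the additive submonoid of ℝ generated by the even-index diagonals {μ_{n,j} : j even, 2 ≤ j ≤ n−2}. -/
open Real

/-- The length of the `k`-th diagonal of a regular `n`-gon with side length 1. -/
noncomputable def polygonDiagonal (n k : ℕ) : ℝ :=
  Real.sin (k * Real.pi / n) / Real.sin (Real.pi / n)

/-- Nonnegative integer combinations of the diagonals whose index has the parity of `r`. -/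
def polygonDiagonalCone (n r : ℕ) : AddSubmonoid ℝ :=
  AddSubmonoid.closure {x : ℝ | ∃ j : ℕ, j ≤ n ∧ Even (j + r) ∧ x = polygonDiagonal n j}

theorem polygonDiagonal_zero (n : ℕ) : polygonDiagonal n 0 = 0 := by
  simp [polygonDiagonal]

theorem polygonDiagonal_self {n : ℕ} (hn : n ≠ 0) : polygonDiagonal n n = 0 := by
  have h : (n : ℝ) ≠ 0 := by exact_mod_cast hn
  simp [polygonDiagonal, mul_div_cancel_left₀ _ h]

theorem polygonDiagonal_sub {n k : ℕ} (hn : n ≠ 0) (hk : k ≤ n) :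
    polygonDiagonal n (n - k) = polygonDiagonal n k := by
  have h : (n : ℝ) ≠ 0 := by exact_mod_cast hn
  unfold polygonDiagonal
  rw [← Real.sin_pi_sub (k * Real.pi / n), Nat.cast_sub hk]
  congr 2
  field_simp

theorem polygonDiagonal_succ_mul_succ {n : ℕ} (hn : 2 ≤ n) (j k : ℕ) :
    polygonDiagonal n (j + 1) * polygonDiagonal n (k + 1) =
      polygonDiagonal n j * polygonDiagonal n k + polygonDiagonal n (j + k + 1) := by
  have hn' : (1 : ℝ) < n := by exact_mod_cast hn
  have hs : Real.sin (Real.pi / n) ≠ 0 :=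
    (Real.sin_pos_of_pos_of_lt_pi (by positivity) (div_lt_self Real.pi_pos hn')).ne'
  unfold polygonDiagonal
  have hj : ((j + 1 : ℕ) : ℝ) * Real.pi / n = j * Real.pi / n + Real.pi / n := by
    push_cast; ring
  have hk : ((k + 1 : ℕ) : ℝ) * Real.pi / n = k * Real.pi / n + Real.pi / n := by
    push_cast; ring
  have hjk : ((j + k + 1 : ℕ) : ℝ) * Real.pi / n =
      j * Real.pi / n + k * Real.pi / n + Real.pi / n := by
    push_cast; ring
  rw [hj, hk, hjk]
  generalize (j : ℝ) * Real.pi / n = a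
  generalize (k : ℝ) * Real.pi / n = b
  generalize Real.pi / (n : ℝ) = t at *
  field_simp
  simp only [Real.sin_add, Real.cos_add]
  linear_combination (Real.sin a * Real.sin b) * Real.sin_sq_add_cos_sq t

theorem polygonDiagonal_mem_cone {n r j : ℕ} (hj : j ≤ n) (h : Even (j + r)) :
    polygonDiagonal n j ∈ polygonDiagonalCone n r :=
  AddSubmonoid.subset_closure ⟨j, hj, h, rfl⟩

theorem polygonDiagonal_mul_mem_cone_of_add_le {n r : ℕ} (hn : 2 ≤ n) (j k : ℕ)
    (hjk : j + k ≤ n + 1) (h : Odd (j + k + r)) :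
    polygonDiagonal n j * polygonDiagonal n k ∈ polygonDiagonalCone n r := by
  induction k generalizing j with
  | zero => simp [polygonDiagonal_zero]
  | succ k ih =>
    cases j with
    | zero => simp [polygonDiagonal_zero]
    | succ j =>
      rw [polygonDiagonal_succ_mul_succ hn]
      exact add_mem (ih j (by omega) (by grind))
        (polygonDiagonal_mem_cone (by omega) (by grind))

theorem polygonDiagonal_mul_mem_cone {n r j k : ℕ} (hn : 2 ≤ n) (hj : j ≤ n) (hk : k ≤ n)
    (h : Odd (j + k + r)) :
    polygonDiagonal n j * polygonDiagonal n k ∈ polygonDiagonalCone n r := by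
  by_cases hjk : j + k ≤ n + 1
  · exact polygonDiagonal_mul_mem_cone_of_add_le hn j k hjk h
  · rw [← polygonDiagonal_sub (by omega) hj, ← polygonDiagonal_sub (by omega) hk]
    exact polygonDiagonal_mul_mem_cone_of_add_le hn _ _ (by omega) (by grind)

theorem mul_polygonDiagonal_mem_cone {n r s k : ℕ} (hn : 2 ≤ n) (hk : k ≤ n)
    (h : Odd (r + k + s)) {x : ℝ} (hx : x ∈ polygonDiagonalCone n r) :
    x * polygonDiagonal n k ∈ polygonDiagonalCone n s := by
  induction hx using AddSubmonoid.closure_induction with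
  | mem x hx =>
    obtain ⟨j, hj, hjr, rfl⟩ := hx
    exact polygonDiagonal_mul_mem_cone hn hj hk (by grind)
  | zero => simp
  | add x y _ _ hx hy =>
    rw [add_mul]
    exact add_mem hx hy

theorem polygonDiagonal_pow_mem_cone {n k : ℕ} (hn : 2 ≤ n) (hk : k ≤ n) (hke : Even k)
    (m : ℕ) : polygonDiagonal n k ^ (2 * m + 1) ∈ polygonDiagonalCone n 0 := by
  induction m with
  | zero => simpa using polygonDiagonal_mem_cone hk (by simpa using hke)
  | succ m ih =>
    rw [show 2 * (m + 1) + 1 = 2 * m + 1 + 1 + 1 by ring, pow_succ, pow_succ]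
    exact mul_polygonDiagonal_mem_cone (r := 1) hn hk (by grind)
      (mul_polygonDiagonal_mem_cone hn hk (by grind) ih)

/-- For even n ≥ 4, odd powers μ_{n,k}^p of even-index diagonals lie in the additive
submonoid of ℝ generated by the even-index diagonals. -/
theorem diagonal_powers_in_S_even (n : ℕ) (hn : 4 ≤ n) (heven : Even n)
    (k : ℕ) (hk : Even k) (hk2 : 2 ≤ k) (hkn : k ≤ n - 2)
    (p : ℕ) (hp : Odd p) (hp1 : 1 ≤ p) :
    (Real.sin (k * Real.pi / n) / Real.sin (Real.pi / n)) ^ p ∈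
      AddSubmonoid.closure {x : ℝ | ∃ j : ℕ, Even j ∧ 2 ≤ j ∧ j ≤ n - 2 ∧
        x = Real.sin (j * Real.pi / n) / Real.sin (Real.pi / n)} := by
  obtain ⟨m, rfl⟩ := hp
  refine (AddSubmonoid.closure_le.2 ?_ :
    polygonDiagonalCone n 0 ≤ _) (polygonDiagonal_pow_mem_cone (by omega) (by omega) hk m)
  rintro _ ⟨j, hj, hje, rfl⟩
  rcases Nat.eq_zero_or_pos j with rfl | hj0
  · rw [polygonDiagonal_zero]
    exact zero_mem _
  rcases hj.eq_or_lt with rfl | hjn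
  · rw [polygonDiagonal_self (by omega)]
    exact zero_mem _
  · exact AddSubmonoid.subset_closure ⟨j, hje, by grind, by grind, rfl⟩
end

section
/- For every even natural number n ≥ 4, every even k and odd h with 1 ≤ h, k ≤ ⌊n/2⌋, there exists a natural number p ≥ 1 and positive integers c_1, …, c_{⌊n/2⌋} (each c_i ≥ 1) such that (μ_{n,k} + μ_{n,h})^p = ∑_{i=1}^{⌊n/2⌋} c_i·μ_{n,i}. -/
/-- The length of the `k`-th diagonal of a regular `n`-gon with side length `1`. -/
noncomputable def diagonal (n k : ℕ) : ℝ :=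
  Real.sin (k * Real.pi / n) / Real.sin (Real.pi / n)

/-- The combinations of the diagonals `1, …, ⌊n/2⌋` with coefficients in `ℕ`. -/
def diagonalCone (n : ℕ) : AddSubmonoid ℝ where
  carrier := {x | ∃ c : ℕ → ℕ, x = ∑ i ∈ Finset.Icc 1 (n / 2), (c i : ℝ) * diagonal n i}
  zero_mem' := ⟨0, by simp⟩
  add_mem' := by
    rintro _ _ ⟨c, rfl⟩ ⟨d, rfl⟩
    exact ⟨c + d, by simp [add_mul, Finset.sum_add_distrib]⟩

section

variable {n : ℕ}

lemma sin_pi_div_pos (hn : 2 ≤ n) : 0 < Real.sin (Real.pi / n) := by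
  have h : (2 : ℝ) ≤ n := by exact_mod_cast hn
  refine Real.sin_pos_of_pos_of_lt_pi (by positivity) ?_
  exact div_lt_self Real.pi_pos (by linarith)

lemma diagonal_zero : diagonal n 0 = 0 := by simp [diagonal]

lemma diagonal_one (hn : 2 ≤ n) : diagonal n 1 = 1 := by
  simp [diagonal, (sin_pi_div_pos hn).ne']

lemma diagonal_reflect (hn : 2 ≤ n) {i : ℕ} (hi : i ≤ n) :
    diagonal n (n - i) = diagonal n i := by
  have h : (n : ℝ) ≠ 0 := by positivity
  have e : ((n - i : ℕ) : ℝ) * Real.pi / n = Real.pi - i * Real.pi / n := by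
    rw [Nat.cast_sub hi]; field_simp
  rw [diagonal, e, Real.sin_pi_sub, diagonal]

lemma diagonal_succ_mul_succ (hn : 2 ≤ n) (i j : ℕ) :
    diagonal n (i + 1) * diagonal n (j + 1) =
      diagonal n i * diagonal n j + diagonal n (i + j + 1) := by
  have hs := (sin_pi_div_pos hn).ne'
  have e1 : ((i + 1 : ℕ) : ℝ) * Real.pi / n = i * Real.pi / n + Real.pi / n := by
    push_cast; ring
  have e2 : ((j + 1 : ℕ) : ℝ) * Real.pi / n = j * Real.pi / n + Real.pi / n := by
    push_cast; ring
  have e3 : ((i + j + 1 : ℕ) : ℝ) * Real.pi / n =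
      (i * Real.pi / n + j * Real.pi / n) + Real.pi / n := by
    push_cast; ring
  simp only [diagonal, e1, e2, e3, Real.sin_add, Real.cos_add]
  generalize (i : ℝ) * Real.pi / n = u
  generalize (j : ℝ) * Real.pi / n = v
  field_simp
  linear_combination Real.sin u * Real.sin v * Real.sin_sq_add_cos_sq (Real.pi / n)

lemma diagonal_mem_diagonalCone (hn : 2 ≤ n) {i : ℕ} (hi : i ≤ n) :
    diagonal n i ∈ diagonalCone n := by
  have key : ∀ j ≤ n / 2, diagonal n j ∈ diagonalCone n := by
    intro j hj
    rcases Nat.eq_zero_or_pos j with rfl | hj0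
    · rw [diagonal_zero]; exact zero_mem _
    · refine ⟨fun a => if a = j then 1 else 0, ?_⟩
      have hmem : j ∈ Finset.Icc 1 (n / 2) := Finset.mem_Icc.2 ⟨hj0, hj⟩
      rw [Finset.sum_eq_single_of_mem j hmem (fun b _ hb => by simp [hb])]
      simp
  by_cases h : i ≤ n / 2
  · exact key i h
  · rw [← diagonal_reflect hn hi]
    exact key _ (by omega)

lemma diagonal_mul_diagonal_mem (hn : 2 ≤ n) (i j : ℕ) (hij : i + j ≤ n) :
    diagonal n i * diagonal n j ∈ diagonalCone n := by
  induction i generalizing j with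
  | zero => rw [diagonal_zero, zero_mul]; exact zero_mem _
  | succ i ih =>
    cases j with
    | zero => rw [diagonal_zero, mul_zero]; exact zero_mem _
    | succ j =>
      rw [diagonal_succ_mul_succ hn]
      exact add_mem (ih j (by omega)) (diagonal_mem_diagonalCone hn (by omega))

lemma mul_mem_diagonalCone (hn : 2 ≤ n) {x y : ℝ} (hx : x ∈ diagonalCone n)
    (hy : y ∈ diagonalCone n) : x * y ∈ diagonalCone n := by
  obtain ⟨c, rfl⟩ := hx
  obtain ⟨d, rfl⟩ := hy
  rw [Finset.sum_mul_sum]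
  refine sum_mem fun i hi => sum_mem fun j hj => ?_
  rw [Finset.mem_Icc] at hi hj
  have h := nsmul_mem (diagonal_mul_diagonal_mem hn i j (by omega)) (c i * d j)
  rw [nsmul_eq_mul] at h
  convert h using 1
  push_cast
  ring

lemma one_mem_diagonalCone (hn : 2 ≤ n) : (1 : ℝ) ∈ diagonalCone n :=
  diagonal_one hn ▸ diagonal_mem_diagonalCone hn (by omega)

lemma pow_mem_diagonalCone (hn : 2 ≤ n) {x : ℝ} (hx : x ∈ diagonalCone n) (p : ℕ) :
    x ^ p ∈ diagonalCone n := by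
  induction p with
  | zero => simpa using one_mem_diagonalCone hn
  | succ p ih => rw [pow_succ]; exact mul_mem_diagonalCone hn ih hx

lemma mul_sub_mul_mem_diagonalCone (hn : 2 ≤ n) {a b c d : ℝ}
    (ha : a ∈ diagonalCone n) (hd : d ∈ diagonalCone n)
    (hab : b - a ∈ diagonalCone n) (hcd : d - c ∈ diagonalCone n) :
    b * d - a * c ∈ diagonalCone n := by
  have h := add_mem (mul_mem_diagonalCone hn hab hd) (mul_mem_diagonalCone hn ha hcd)
  convert h using 1
  ring

lemma diagonal_sq_sub_sq_mem (hn : 2 ≤ n) {i j : ℕ} (hij : i ≤ j) (hj : j ≤ n / 2) :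
    diagonal n j ^ 2 - diagonal n i ^ 2 ∈ diagonalCone n := by
  induction j, hij using Nat.le_induction with
  | base => rw [sub_self]; exact zero_mem _
  | succ j _ ih =>
    have h := add_mem (ih (by omega))
      (diagonal_mem_diagonalCone hn (i := j + j + 1) (by omega))
    convert h using 1
    rw [sq (diagonal n (j + 1)), diagonal_succ_mul_succ hn]
    ring

lemma diagonal_two_sq (hn : 2 ≤ n) : diagonal n 2 ^ 2 = 1 + diagonal n 3 := by
  rw [sq, diagonal_succ_mul_succ hn 1 1, diagonal_one hn, one_mul]

lemma diagonal_two_mul (hn : 2 ≤ n) (i : ℕ) :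
    diagonal n 2 * diagonal n (i + 1) = diagonal n i + diagonal n (i + 2) := by
  have h := diagonal_succ_mul_succ hn 1 i
  rwa [diagonal_one hn, one_mul, show 1 + i + 1 = i + 2 by ring] at h

lemma diagonal_two_sq_mul (hn : 2 ≤ n) (i : ℕ) :
    diagonal n 2 ^ 2 * diagonal n (i + 2) =
      diagonal n i + 2 * diagonal n (i + 2) + diagonal n (i + 4) := by
  have h0 := diagonal_two_mul hn i
  have h1 := diagonal_two_mul hn (i + 1)
  have h2 := diagonal_two_mul hn (i + 2)
  simp only [add_assoc, Nat.reduceAdd] at h1 h2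
  linear_combination diagonal n 2 * h1 + h0 + h2

/-- A relation closed under steps of length two in both directions on `[1, n - 1]`
propagates along parity classes. -/
lemma parity_propagation {P : ℕ → Prop}
    (up : ∀ i, 1 ≤ i → i + 2 ≤ n → P i → P (i + 2))
    (down : ∀ i, 1 ≤ i → i + 3 ≤ n → P (i + 2) → P i)
    {i j : ℕ} (hi : 1 ≤ i) (hin : i + 1 ≤ n) (hj : 1 ≤ j) (hjn : j + 1 ≤ n)
    (hij : i % 2 = j % 2) (h : P j) : P i := by
  have climb : ∀ t a, 1 ≤ a → a + 2 * t + 1 ≤ n → (P a ↔ P (a + 2 * t)) := by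
    intro t
    induction t with
    | zero => simp
    | succ t ih =>
      intro a ha hat
      exact (ih a ha (by omega)).trans
        ⟨up (a + 2 * t) (by omega) (by omega), down (a + 2 * t) (by omega) (by omega)⟩
  rcases le_total i j with hle | hle
  · refine (climb ((j - i) / 2) i hi (by omega)).2 ?_
    rwa [show i + 2 * ((j - i) / 2) = j by omega]
  · rw [show i = j + 2 * ((i - j) / 2) by omega]
    exact (climb ((i - j) / 2) j hj (by omega)).1 h

/-- If the cone contains `x`, `x ^ 2 - μ₂ ^ 2` and `x ^ 2 - μⱼ` for an even `j`, then
for each diagonal `μᵢ` it contains `x ^ (2 * s) - μᵢ` for some `s`. -/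
lemma exists_pow_sub_diagonal_mem (hn : 4 ≤ n) {x : ℝ} (hx : x ∈ diagonalCone n)
    (h2 : x ^ 2 - diagonal n 2 ^ 2 ∈ diagonalCone n)
    {j : ℕ} (hj : Even j) (hj1 : 1 ≤ j) (hjn : j + 1 ≤ n)
    (hxj : x ^ 2 - diagonal n j ∈ diagonalCone n)
    {i : ℕ} (hi : 1 ≤ i) (hin : i + 1 ≤ n) :
    ∃ s : ℕ, (x ^ 2) ^ s - diagonal n i ∈ diagonalCone n := by
  have hn2 : 2 ≤ n := by omega
  have hmem : ∀ {a}, a ≤ n → diagonal n a ∈ diagonalCone n :=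
    fun ha => diagonal_mem_diagonalCone hn2 ha
  have step : ∀ a b, a ≤ n →
      diagonal n 2 ^ 2 * diagonal n a - diagonal n b ∈ diagonalCone n →
      (∃ s : ℕ, (x ^ 2) ^ s - diagonal n a ∈ diagonalCone n) →
      ∃ s : ℕ, (x ^ 2) ^ s - diagonal n b ∈ diagonalCone n := by
    rintro a b ha hab ⟨s, hs⟩
    refine ⟨s + 1, ?_⟩
    have h := add_mem (mul_sub_mul_mem_diagonalCone hn2
      (pow_mem_diagonalCone hn2 (hmem (by omega)) 2)
      (pow_mem_diagonalCone hn2 (pow_mem_diagonalCone hn2 hx 2) s) h2 hs) hab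
    convert h using 1
    ring
  have up : ∀ a, 1 ≤ a → a + 2 ≤ n →
      (∃ s : ℕ, (x ^ 2) ^ s - diagonal n a ∈ diagonalCone n) →
      ∃ s : ℕ, (x ^ 2) ^ s - diagonal n (a + 2) ∈ diagonalCone n := by
    intro a ha han
    refine step a (a + 2) (by omega) ?_
    rcases Nat.lt_or_ge a 2 with h | h
    · obtain rfl : a = 1 := by omega
      rw [diagonal_two_sq hn2, diagonal_one hn2]
      simpa using one_mem_diagonalCone hn2
    · obtain ⟨b, rfl⟩ := Nat.exists_eq_add_of_le' h
      rw [diagonal_two_sq_mul hn2]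
      have h := add_mem (hmem (a := b) (by omega))
        (add_mem (hmem (a := b + 2) (by omega)) (hmem (a := b + 2) (by omega)))
      convert h using 1
      simp only [add_assoc, Nat.reduceAdd]
      ring
  have down : ∀ a, 1 ≤ a → a + 3 ≤ n →
      (∃ s : ℕ, (x ^ 2) ^ s - diagonal n (a + 2) ∈ diagonalCone n) →
      ∃ s : ℕ, (x ^ 2) ^ s - diagonal n a ∈ diagonalCone n := by
    intro a ha han
    refine step (a + 2) a (by omega) ?_
    have h := mul_mem_diagonalCone hn2 (hmem (a := 2) (by omega))
      (hmem (a := a + 3) (by omega))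
    have h' := add_mem (hmem (a := a + 2) (by omega)) h
    convert h' using 1
    have e := diagonal_two_mul hn2 (a + 2)
    simp only [add_assoc, Nat.reduceAdd] at e
    rw [diagonal_two_sq_mul hn2, e]
    ring
  rcases Nat.even_or_odd i with he | ho
  · rw [Nat.even_iff] at he hj
    exact parity_propagation up down hi hin hj1 hjn (by omega) ⟨1, by simpa using hxj⟩
  · rw [Nat.odd_iff] at ho
    refine parity_propagation up down hi hin le_rfl (by omega) (by omega) ⟨0, ?_⟩
    rw [diagonal_one hn2]
    simp [zero_mem]

/-- If the cone contains `x ^ 2 - 2` and each term of a finite sum is dominated, modulo the cone,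
by a power of `x ^ 2`, then so is the sum. -/
lemma exists_pow_sub_sum_mem (hn : 2 ≤ n) {x : ℝ} (hx : x ∈ diagonalCone n)
    (htwo : x ^ 2 - 2 ∈ diagonalCone n) {f : ℕ → ℝ} (s : Finset ℕ)
    (h : ∀ i ∈ s, ∃ t : ℕ, (x ^ 2) ^ t - f i ∈ diagonalCone n) :
    ∃ t : ℕ, (x ^ 2) ^ (t + 1) - ∑ i ∈ s, f i ∈ diagonalCone n := by
  have hpow : ∀ t : ℕ, (x ^ 2) ^ t ∈ diagonalCone n :=
    pow_mem_diagonalCone hn (pow_mem_diagonalCone hn hx 2)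
  have hone := one_mem_diagonalCone hn
  have hsub : x ^ 2 - 1 ∈ diagonalCone n := by
    convert add_mem htwo hone using 1
    ring
  have mono : ∀ a b : ℕ, (x ^ 2) ^ (a + b) - (x ^ 2) ^ a ∈ diagonalCone n := by
    intro a b
    induction b with
    | zero => simp [zero_mem]
    | succ b ih =>
      convert add_mem ih (mul_mem_diagonalCone hn (hpow (a + b)) hsub) using 1
      ring
  induction s using Finset.induction_on with
  | empty => exact ⟨0, by simpa using hpow 1⟩
  | insert i s his ih =>
    obtain ⟨a, ha⟩ := ih fun j hj => h j (Finset.mem_insert_of_mem hj)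
    obtain ⟨b, hb⟩ := h i (Finset.mem_insert_self i s)
    refine ⟨a + 1 + b, ?_⟩
    rw [Finset.sum_insert his]
    have h1 := add_mem ha (mono (a + 1) b)
    have h2 := add_mem hb (mono b (a + 1))
    convert add_mem (add_mem h1 h2) (mul_mem_diagonalCone hn (hpow (a + 1 + b)) htwo) using 1
    ring

end

/-- For even n ≥ 4, even k and odd h with 1 ≤ h, k ≤ ⌊n/2⌋, some power of
μ_{n,k} + μ_{n,h} is a positive integer combination ∑_{i=1}^{⌊n/2⌋} c_i μ_{n,i}
with all c_i ≥ 1. -/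
theorem mixed_diagonal_power_in_S_full_even (n : ℕ) (hn : 4 ≤ n) (heven : Even n)
    (k h : ℕ) (hke : Even k) (hho : Odd h)
    (hk1 : 1 ≤ k) (hkn : k ≤ n / 2) (hh1 : 1 ≤ h) (hhn : h ≤ n / 2) :
    ∃ p : ℕ, 1 ≤ p ∧ ∃ c : ℕ → ℕ, (∀ i ∈ Finset.Icc 1 (n / 2), 1 ≤ c i) ∧
      (Real.sin (k * Real.pi / n) / Real.sin (Real.pi / n)
        + Real.sin (h * Real.pi / n) / Real.sin (Real.pi / n)) ^ p =
        ∑ i ∈ Finset.Icc 1 (n / 2),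
          (c i : ℝ) * (Real.sin (i * Real.pi / n) / Real.sin (Real.pi / n)) := by
  have hn2 : 2 ≤ n := by omega
  have hk2 : 2 ≤ k := by
    rw [Nat.even_iff] at hke
    omega
  set x : ℝ := diagonal n k + diagonal n h with hxdef
  have hx : x ∈ diagonalCone n :=
    add_mem (diagonal_mem_diagonalCone hn2 (by omega)) (diagonal_mem_diagonalCone hn2 (by omega))
  have hkk := diagonal_sq_sub_sq_mem hn2 hk2 hkn
  have hhh := diagonal_sq_sub_sq_mem hn2 hh1 hhn
  have hkh := diagonal_mul_diagonal_mem hn2 k h (by omega)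
  have hone := one_mem_diagonalCone hn2
  have hthree : diagonal n 3 ∈ diagonalCone n := diagonal_mem_diagonalCone hn2 (by omega)
  have hsq2 := diagonal_two_sq hn2
  rw [diagonal_one hn2] at hhh
  have h2 : x ^ 2 - diagonal n 2 ^ 2 ∈ diagonalCone n := by
    convert add_mem (add_mem hkk (add_mem hhh hone)) (add_mem hkh hkh) using 1
    rw [hxdef]
    ring
  have htwo : x ^ 2 - 2 ∈ diagonalCone n := by
    convert add_mem (add_mem (add_mem hkk hthree) hhh) (add_mem hkh hkh) using 1
    rw [hxdef]
    linear_combination hsq2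
  obtain ⟨a, rfl⟩ := Nat.exists_eq_add_of_le' hk1
  obtain ⟨b, rfl⟩ := Nat.exists_eq_add_of_le' hh1
  have hab : diagonal n a * diagonal n b ∈ diagonalCone n :=
    diagonal_mul_diagonal_mem hn2 a b (by omega)
  have hxj : x ^ 2 - diagonal n (a + b + 1) ∈ diagonalCone n := by
    convert add_mem (add_mem (add_mem (add_mem hkk hthree) hhh)
      (add_mem hone hone)) (add_mem hkh hab) using 1
    rw [hxdef]
    linear_combination hsq2 + diagonal_succ_mul_succ hn2 a b
  have hj : Even (a + b + 1) := by
    rw [Nat.even_iff] at hke ⊢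
    rw [Nat.odd_iff] at hho
    omega
  obtain ⟨t, c, hc⟩ := exists_pow_sub_sum_mem hn2 hx htwo (f := diagonal n)
    (Finset.Icc 1 (n / 2)) fun i hi => by
      rw [Finset.mem_Icc] at hi
      exact exists_pow_sub_diagonal_mem hn hx h2 hj (by omega) (by omega) hxj hi.1 (by omega)
  refine ⟨2 * (t + 1), by omega, fun i => c i + 1, fun i _ => Nat.le_add_left 1 (c i), ?_⟩
  change x ^ (2 * (t + 1)) = ∑ i ∈ Finset.Icc 1 (n / 2), ((c i + 1 : ℕ) : ℝ) * diagonal n i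
  rw [pow_mul, sub_eq_iff_eq_add.1 hc, ← Finset.sum_add_distrib]
  exact Finset.sum_congr rfl fun i _ => by push_cast; ring
end
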